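/- Fix j with 1 ≤ j ≤ k. Assume that d < d_a for every a = 1, …, k, that V_sing is finite with V_sing ∩ H = ∅, and that the singular loci Z_{j,sing} and Z_{j+1,sing} are contained in V_sing. Then the critical set Σ_1 = {x ∈ ℂ^{N+1} : f_{j+1}(x) = ⋯ = f_k(x) = 0, h(x) = 1, f_j(x) ≠ 0, the gradients d_x h, d_x f_{j+1}, …, d_x f_k are linearly independent over ℂ, and d_x f_j lies in the ℂ-linear span of d_x h, d_x f_{j+1}, …, d_x f_k} is a finite subset of ℂ^{N+1}. -/

import Mathlib

open MvPolynomial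

/-- The gradient (vector of partial derivatives) of a polynomial `f` evaluated at `x`. -/
noncomputable def pgrad {N : ℕ} (f : MvPolynomial (Fin (N + 1)) ℂ) (x : Fin (N + 1) → ℂ) :
    Fin (N + 1) → ℂ :=
  fun i => eval x (pderiv i f)

theorem Algebra.FormallySmooth.of_charZero_field (F K : Type) [Field F] [CharZero F] [Field K] [Algebra F K] :
    Algebra.FormallySmooth F K := by
  obtain ⟨ι, x, hx⟩ := exists_isTranscendenceBasis' F K
  have := hx.isAlgebraic_field
  exact Algebra.FormallySmooth.of_algebraicIndependent_of_isSeparable hx.1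

theorem Algebra.FormallySmooth.exists_section {P A B : Type} [CommRing P] [CommRing A] [CommRing B]
    [Algebra P A] [Algebra P B] [Algebra.FormallySmooth P A] (g : B →ₐ[P] A)
    (hg : Function.Surjective g) (hn : IsNilpotent (RingHom.ker (g : B →+* A))) :
    ∃ s : A →ₐ[P] B, ∀ a, g (s a) = a :=
  ⟨Algebra.FormallySmooth.liftOfSurjective (AlgHom.id P A) g hg hn, fun a =>
    Algebra.FormallySmooth.liftOfSurjective_apply (AlgHom.id P A) g hg hn a⟩

/-- A transcendental element in characteristic zero is not killed by all derivations. -/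
theorem exists_derivation_eq_one_of_transcendental {k K : Type} [Field k] [CharZero k] [Field K] [Algebra k K] {c : K}
    (hc : Transcendental k c) : ∃ D : Derivation k K K, D c = 1 := by
  let φ : Polynomial k →ₐ[k] K := Polynomial.aeval c
  let ψ : Polynomial k →ₐ[k] TrivSqZeroExt K K := Polynomial.aeval (TrivSqZeroExt.inl c + TrivSqZeroExt.inr 1)
  have hfst : ∀ p, TrivSqZeroExt.fst (ψ p) = φ p := by
    intro p
    have : (TrivSqZeroExt.fstHom k K K).comp ψ = φ := by
      ext; simp [φ, ψ]
    exact DFunLike.congr_fun this p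
  have hinj : Function.Injective φ := transcendental_iff_injective.1 hc
  let a1 : Algebra (Polynomial k) K := φ.toRingHom.toAlgebra
  let a2 : Algebra (Polynomial k) (TrivSqZeroExt K K) := ψ.toRingHom.toAlgebra
  let F := FractionRing (Polynomial k)
  have : FaithfulSMul (Polynomial k) K := (faithfulSMul_iff_algebraMap_injective _ _).2 hinj
  let a3 : Algebra F K := FractionRing.liftAlgebra (Polynomial k) K
  have : IsScalarTower (Polynomial k) F K := FractionRing.isScalarTower_liftAlgebra _ _
  have : CharZero F := charZero_of_injective_algebraMap (IsFractionRing.injective (Polynomial k) F)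
  have : Algebra.FormallySmooth F K := Algebra.FormallySmooth.of_charZero_field F K
  have : Algebra.FormallyEtale (Polynomial k) F :=
    Algebra.FormallyEtale.of_isLocalization (nonZeroDivisors (Polynomial k))
  have : Algebra.FormallySmooth (Polynomial k) K := Algebra.FormallySmooth.comp _ F _
  let g : @AlgHom (Polynomial k) (TrivSqZeroExt K K) K _ _ _ a2 a1 :=
    { TrivSqZeroExt.fstHom K K K with
      commutes' := hfst }
  obtain ⟨s, hs⟩ := Algebra.FormallySmooth.exists_section g
    (fun z => ⟨TrivSqZeroExt.inl z, rfl⟩) (by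
      refine ⟨2, ?_⟩
      rw [pow_two, Ideal.zero_eq_bot, eq_bot_iff, Ideal.mul_le]
      intro z hz w hw
      have hz' : TrivSqZeroExt.fst z = 0 := hz
      have hw' : TrivSqZeroExt.fst w = 0 := hw
      rw [Ideal.mem_bot]
      ext <;> simp [hz', hw'])
  have hs1 : ∀ a, TrivSqZeroExt.fst (s a) = a := hs
  have hsC : ∀ p, s (φ p) = ψ p := fun p => s.commutes p
  refine ⟨Derivation.mk'
    { toFun := fun a => TrivSqZeroExt.snd (s a)
      map_add' := by simp
      map_smul' := fun r a => ?_ } fun a b => ?_, ?_⟩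
  · have : r • a = φ (Polynomial.C r) * a := by simp [φ, Algebra.smul_def]
    rw [this, map_mul, hsC]
    simp [ψ, hs1, Algebra.smul_def, TrivSqZeroExt.algebraMap_eq_inl']
  · simp [hs1, mul_comm]
  · have := hsC Polynomial.X
    simp only [φ, ψ, Polynomial.aeval_X] at this
    simp [this]

theorem Derivation.map_mvPolynomial_aeval {k K σ : Type} [Fintype σ] [CommRing k] [CommRing K]
    [Algebra k K] (D : Derivation k K K) (x : σ → K) (p : MvPolynomial σ k) :
    D (aeval x p) = ∑ i, aeval x (pderiv i p) * D (x i) := by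
  classical
  induction p using MvPolynomial.induction_on with
  | C a => simp
  | add p q hp hq => simp [hp, hq, add_mul, Finset.sum_add_distrib]
  | mul_X p j hp =>
    simp only [map_mul, Derivation.leibniz, hp, aeval_X, smul_eq_mul, pderiv_X, map_add, add_mul,
      Finset.sum_add_distrib, Finset.mul_sum]
    congr 1
    · simp [Pi.single_apply]
    · exact Finset.sum_congr rfl fun i _ => by ring

theorem MvPolynomial.IsHomogeneous.aeval_mul {k K σ : Type} [CommRing k] [CommRing K]
    [Algebra k K] {p : MvPolynomial σ k} {e : ℕ} (hp : p.IsHomogeneous e) (t : K) (x : σ → K) :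
    MvPolynomial.aeval (fun i => t * x i) p = t ^ e * MvPolynomial.aeval x p := by
  rw [MvPolynomial.aeval_def, MvPolynomial.aeval_def, eval₂_eq, eval₂_eq, Finset.mul_sum]
  refine Finset.sum_congr rfl fun m hm => ?_
  have h1 : ∑ i ∈ m.support, m i = e := by
    have := hp (mem_support_iff.1 hm)
    simpa [Finsupp.weight_apply, Finsupp.sum] using this
  simp only [mul_pow, Finset.prod_mul_distrib, Finset.prod_pow_eq_pow_sum, h1]
  ring

theorem MvPolynomial.IsHomogeneous.sum_mul_aeval_pderiv {k K σ : Type} [Fintype σ] [CommRing k]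
    [CommRing K] [Algebra k K] {p : MvPolynomial σ k} {e : ℕ} (hp : p.IsHomogeneous e)
    (x : σ → K) : ∑ i, x i * MvPolynomial.aeval x (pderiv i p) = e * MvPolynomial.aeval x p := by
  have := congrArg (MvPolynomial.aeval x) hp.sum_X_mul_pderiv
  simpa using this

theorem ValuationSubring.exists_forall_div_mem {K ι : Type} [Field K] [Fintype ι] (O : ValuationSubring K)
    (a : ι → K) {i₀ : ι} (h : a i₀ ≠ 0) : ∃ i, a i ≠ 0 ∧ ∀ j, a j / a i ∈ O := by
  obtain ⟨i, -, hi⟩ := Finset.exists_max_image Finset.univ (fun i => O.valuation (a i)) ⟨i₀, Finset.mem_univ _⟩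
  have hne : a i ≠ 0 := by
    intro h0
    have := hi i₀ (Finset.mem_univ _)
    simp [h0] at this
    exact h this
  refine ⟨i, hne, fun j => ?_⟩
  obtain ⟨b, hb⟩ := (O.valuation_le_iff _ _).1 (hi j (Finset.mem_univ _))
  rw [← hb, mul_div_cancel_right₀ _ hne]
  exact b.2

theorem exists_valuationSubring_notMem_of_transcendental {k K : Type} [Field k] [Field K] [Algebra k K] {x : K}
    (hx : Transcendental k x) :
    ∃ O : ValuationSubring K, (∀ z, IsAlgebraic k z → z ∈ O) ∧ x ∉ O := by
  have hI : IsIntegrallyClosedIn (integralClosure k K).toSubring K :=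
    inferInstanceAs (IsIntegrallyClosedIn (integralClosure k K) K)
  obtain ⟨V, hV, hxV⟩ := Subring.exists_le_valuationSubring_of_isIntegrallyClosedIn
    (R := (integralClosure k K).toSubring) (x := x) (fun h => hx (IsIntegral.isAlgebraic h))
  exact ⟨V, fun z hz => hV hz.isIntegral, hxV⟩

/-- A point with coordinates in any nontrivial algebra specialises to a rational point. -/
theorem MvPolynomial.exists_eval_eq_zero_of_aeval_eq_zero {k A σ : Type} [Field k] [IsAlgClosed k]
    [CommRing A] [Nontrivial A] [Algebra k A] [Finite σ] (z : σ → A) :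
    ∃ w : σ → k, ∀ p : MvPolynomial σ k, aeval z p = 0 → eval w p = 0 := by
  obtain ⟨M, hM, hle⟩ := Ideal.exists_le_maximal (RingHom.ker (aeval z : MvPolynomial σ k →ₐ[k] A))
    (RingHom.ker_ne_top _)
  obtain ⟨w, rfl⟩ := (isMaximal_iff_eq_vanishingIdeal_singleton).1 hM
  exact ⟨w, fun p hp => by simpa [aeval_eq_eval] using hle hp⟩

/-- A function taking infinitely many values becomes transcendental modulo a suitable prime of the
ring of functions. -/
theorem exists_prime_transcendental_mk {k S : Type} [Field k] (u : S → k) (hu : (Set.range u).Infinite) :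
    ∃ P : Ideal (S → k), P.IsPrime ∧ Transcendental k (Ideal.Quotient.mk P u) := by
  let M : Submonoid (S → k) := (nonZeroDivisors (Polynomial k)).map (Polynomial.aeval u)
  obtain ⟨P, hP, -, hd⟩ := Ideal.exists_le_prime_disjoint (⊥ : Ideal (S → k)) M (by
    rw [Set.disjoint_left]
    rintro _ h0 ⟨p, hp, rfl⟩
    refine nonZeroDivisors.ne_zero hp (Polynomial.eq_zero_of_infinite_isRoot p (hu.mono ?_))
    rintro _ ⟨s, rfl⟩
    have := congrFun (show Polynomial.aeval u p = 0 from h0) s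
    have h1 := Polynomial.aeval_algHom_apply (Pi.evalAlgHom k (fun _ : S => k) s) u p
    simpa [this] using h1)
  refine ⟨P, hP, ?_⟩
  rw [transcendental_iff]
  intro p hp
  by_contra hne
  refine Set.disjoint_left.1 hd ?_ ⟨p, mem_nonZeroDivisors_of_ne_zero hne, rfl⟩
  rw [← Ideal.Quotient.mkₐ_eq_mk k, Polynomial.aeval_algHom_apply] at hp
  exact Ideal.Quotient.eq_zero_iff_mem.1 hp

theorem MvPolynomial.exists_common_zero_of_exists_aeval {k A σ τ : Type} [Field k] [IsAlgClosed k]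
    [CommRing A] [Nontrivial A] [Algebra k A] [Finite σ] [Fintype τ] {κ : Type}
    (h : κ → MvPolynomial σ k) (G : τ → MvPolynomial σ k) (y : σ → A) (c : τ → A)
    {i₁ : σ} {a₁ : τ} (hy : y i₁ = 1) (hc : c a₁ = 1) (hh : ∀ b, aeval y (h b) = 0)
    (hG : ∀ i, ∑ a, c a * aeval y (pderiv i (G a)) = 0) :
    ∃ (w : σ → k) (ν : τ → k), w i₁ = 1 ∧ ν a₁ = 1 ∧ (∀ b, eval w (h b) = 0) ∧
      ∀ i, ∑ a, ν a * eval w (pderiv i (G a)) = 0 := by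
  obtain ⟨w, hw⟩ := MvPolynomial.exists_eval_eq_zero_of_aeval_eq_zero (k := k) (Sum.elim y c)
  have key : ∀ p : MvPolynomial σ k,
      aeval (Sum.elim y c) (rename Sum.inl p) = aeval y p := fun p => by
    rw [aeval_rename]; rfl
  refine ⟨w ∘ Sum.inl, w ∘ Sum.inr, ?_, ?_, fun b => ?_, fun i => ?_⟩
  · have := hw (X (Sum.inl i₁) - 1) (by simp [hy])
    rw [map_sub, eval_X, map_one, sub_eq_zero] at this
    exact this
  · have := hw (X (Sum.inr a₁) - 1) (by simp [hc])
    rw [map_sub, eval_X, map_one, sub_eq_zero] at this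
    exact this
  · simpa [eval_rename] using hw (rename Sum.inl (h b)) (by rw [key, hh])
  · have := hw (∑ a, X (Sum.inr a) * rename Sum.inl (pderiv i (G a))) (by simpa [key] using hG i)
    rw [map_sum] at this
    simp_rw [map_mul, eval_X, eval_rename] at this
    exact this

/-- Specialisation of a critical point along a place at which some coordinate is infinite and the
critical value is finite. -/
theorem exists_common_zero_at_infinity {k K σ τ : Type} [Field k] [IsAlgClosed k] [Field K]
    [Algebra k K] [Fintype σ] [Fintype τ] {d : ℕ} {e : τ → ℕ} {h : MvPolynomial σ k}
    {G : τ → MvPolynomial σ k} (hh : h.IsHomogeneous d) (hG : ∀ a, (G a).IsHomogeneous (e a))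
    (hd : 1 ≤ d) {j₀ : τ} (hde : d < e j₀)
    (O : ValuationSubring K) (hO : ∀ z : k, algebraMap k K z ∈ O) {x : σ → K} {i₀ : σ}
    (hi₀ : x i₀ ∉ O) (hxh : aeval x h = 1) (hxG : ∀ a, a ≠ j₀ → aeval x (G a) = 0)
    (hxj : aeval x (G j₀) ∈ O) {l₀ : K} (hl₀ : l₀ ∈ O) {l : τ → K} (hl : l j₀ = 1)
    (hrel : ∀ i, ∑ a, l a * aeval x (pderiv i (G a)) = l₀ * aeval x (pderiv i h)) :
    ∃ (w : σ → k) (ν : τ → k), w ≠ 0 ∧ ν ≠ 0 ∧ eval w h = 0 ∧ (∀ a, eval w (G a) = 0) ∧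
      ∀ i, ∑ a, ν a * eval w (pderiv i (G a)) = 0 := by
  obtain ⟨i₁, hi₁, hdiv⟩ := O.exists_forall_div_mem x (i₀ := i₀)
    (fun h0 => hi₀ (h0 ▸ O.zero_mem))
  set t : K := (x i₁)⁻¹ with ht
  have ht0 : t ≠ 0 := inv_ne_zero hi₁
  have hxi₁ : x i₁ ∉ O := fun hmem => hi₀ (by
    simpa [div_mul_cancel₀ _ hi₁] using O.mul_mem _ _ (hdiv i₀) hmem)
  have htO : t ∈ O := (O.mem_or_inv_mem (x i₁)).resolve_left hxi₁
  have hpd : ∀ (p : MvPolynomial σ k) (n : ℕ), p.IsHomogeneous n → ∀ i,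
      aeval (fun i => t * x i) (pderiv i p) = t ^ (n - 1) * aeval x (pderiv i p) :=
    fun p n hp i => MvPolynomial.IsHomogeneous.aeval_mul hp.pderiv t x
  obtain ⟨a₁, ha₁, hcO⟩ := O.exists_forall_div_mem (fun a => l a * (t ^ (e a - 1))⁻¹) (i₀ := j₀)
    (by simp [hl, ht0])
  set β : K := l a₁ * (t ^ (e a₁ - 1))⁻¹ with hβ
  set c : τ → K := fun a => l a * (t ^ (e a - 1))⁻¹ / β with hc
  have hcrel : ∀ i, ∑ a, c a * aeval (fun i => t * x i) (pderiv i (G a)) =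
      c j₀ * l₀ * t ^ (e j₀ - d) * aeval (fun i => t * x i) (pderiv i h) := by
    intro i
    have h1 : ∑ a, c a * aeval (fun i => t * x i) (pderiv i (G a)) =
        β⁻¹ * ∑ a, l a * aeval x (pderiv i (G a)) := by
      rw [Finset.mul_sum]
      refine Finset.sum_congr rfl fun a _ => ?_
      rw [hpd _ _ (hG a)]
      have := pow_ne_zero (e a - 1) ht0
      simp only [hc]
      field_simp
    have h2 : t ^ (e j₀ - 1) = t ^ (e j₀ - d) * t ^ (d - 1) := by
      rw [← pow_add]; congr 1; omega
    rw [h1, hrel, hpd _ _ hh]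
    simp only [hc, hl, h2]
    have := pow_ne_zero (e j₀ - d) ht0
    have := pow_ne_zero (d - 1) ht0
    field_simp
  let alg : Algebra k O := ((algebraMap k K).codRestrict O.toSubring hO).toAlgebra
  have tower : IsScalarTower k O K := IsScalarTower.of_algebraMap_eq fun _ => rfl
  let u' : σ → O := fun i => ⟨t * x i, by simpa [ht, div_eq_inv_mul] using hdiv i⟩
  let c' : τ → O := fun a => ⟨c a, hcO a⟩
  let t' : O := ⟨t, htO⟩
  have hu' : ∀ p : MvPolynomial σ k, ((aeval u' p : O) : K) = aeval (fun i => t * x i) p :=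
    fun p => (aeval_algebraMap_apply K u' p).symm
  have htu : ¬ IsUnit t' := by
    rintro ht'
    obtain ⟨s, hs⟩ := ht'.exists_right_inv
    have hs' : t * (s : K) = 1 := congrArg Subtype.val hs
    have : (s : K) = x i₁ := by
      rw [ht] at hs'; field_simp at hs'; exact hs'
    exact hxi₁ (this ▸ s.2)
  let I : Ideal O := Ideal.span {t'}
  have : Nontrivial (O ⧸ I) := Ideal.Quotient.nontrivial_iff.2 (by
    rwa [Ne, Ideal.span_singleton_eq_top])
  have htI : Ideal.Quotient.mkₐ k I t' = 0 :=
    Ideal.Quotient.eq_zero_iff_mem.2 (Ideal.mem_span_singleton_self _)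
  have hq : ∀ p : MvPolynomial σ k, aeval (fun i => Ideal.Quotient.mkₐ k I (u' i)) p =
      Ideal.Quotient.mkₐ k I (aeval u' p) := fun p => by
    rw [← comp_aeval]; rfl
  have hh' : aeval u' h = t' ^ d := Subtype.ext (by
    rw [hu', hh.aeval_mul, hxh, mul_one]; rfl)
  have hG' : ∀ a, a ≠ j₀ → aeval u' (G a) = 0 := fun a ha => Subtype.ext (by
    rw [hu', (hG a).aeval_mul, hxG a ha, mul_zero]; rfl)
  have hj' : aeval u' (G j₀) = t' ^ e j₀ * ⟨_, hxj⟩ := Subtype.ext (by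
    rw [hu', (hG j₀).aeval_mul]; rfl)
  have hrel' : ∀ i, ∑ a, c' a * aeval u' (pderiv i (G a)) =
      c' j₀ * ⟨l₀, hl₀⟩ * t' ^ (e j₀ - d) * aeval u' (pderiv i h) := fun i => Subtype.ext (by
    have := hcrel i
    simp only [← hu'] at this
    push_cast
    exact this)
  obtain ⟨w, ν, hw, hν, hz, hr⟩ := MvPolynomial.exists_common_zero_of_exists_aeval
    (fun o : Option τ => o.elim h G) G (fun i => Ideal.Quotient.mkₐ k I (u' i))
    (fun a => Ideal.Quotient.mkₐ k I (c' a)) (i₁ := i₁) (a₁ := a₁)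
    (by
      have : u' i₁ = 1 := Subtype.ext (inv_mul_cancel₀ hi₁)
      rw [this, map_one])
    (by
      have : c' a₁ = 1 := Subtype.ext (div_self ha₁)
      rw [this, map_one])
    (by
      rintro (_ | a)
      · simp only [Option.elim_none]
        rw [hq, hh', map_pow, htI, zero_pow (by omega)]
      · simp only [Option.elim_some]
        rw [hq]
        by_cases ha : a = j₀
        · rw [ha, hj', map_mul, map_pow, htI, zero_pow (by omega), zero_mul]
        · rw [hG' a ha, map_zero])
    (fun i => by
      simp only [hq, ← map_mul, ← map_sum, hrel']
      rw [map_mul, map_mul, map_pow, htI, zero_pow (by omega), mul_zero, zero_mul])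
  refine ⟨w, ν, fun h0 => ?_, fun h0 => ?_, hz none, fun a => hz (some a), hr⟩
  · simp [h0] at hw
  · simp [h0] at hν

/-- A non-constant family of critical points of `G j₀` on `{G a = 0 for a ≠ j₀, h = 1}` forces a
projective point of `{h = 0}` at which all `G a` vanish with linearly dependent gradients. -/
theorem exists_common_zero_of_transcendental {k K σ τ : Type} [Field k] [IsAlgClosed k] [CharZero k] [Field K]
    [Algebra k K] [Fintype σ] [Fintype τ] {d : ℕ} {e : τ → ℕ} {h : MvPolynomial σ k}
    {G : τ → MvPolynomial σ k} (hh : h.IsHomogeneous d) (hG : ∀ a, (G a).IsHomogeneous (e a))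
    (hd : 1 ≤ d) {j₀ : τ} (hde : d < e j₀) {x : σ → K} {i₀ : σ}
    (hi₀ : Transcendental k (x i₀)) (hxh : aeval x h = 1)
    (hxG : ∀ a, a ≠ j₀ → aeval x (G a) = 0) {l₀ : K} {l : τ → K} (hl : l j₀ = 1)
    (hrel : ∀ i, ∑ a, l a * aeval x (pderiv i (G a)) = l₀ * aeval x (pderiv i h)) :
    ∃ (w : σ → k) (ν : τ → k), w ≠ 0 ∧ ν ≠ 0 ∧ eval w h = 0 ∧ (∀ a, eval w (G a) = 0) ∧
      ∀ i, ∑ a, ν a * eval w (pderiv i (G a)) = 0 := by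
  have contract : ∀ y : σ → K, ∑ a, l a * ∑ i, aeval x (pderiv i (G a)) * y i =
      l₀ * ∑ i, aeval x (pderiv i h) * y i := by
    intro y
    calc _ = ∑ i, (∑ a, l a * aeval x (pderiv i (G a))) * y i := by
          simp only [Finset.mul_sum, Finset.sum_mul]
          rw [Finset.sum_comm]
          simp only [mul_assoc]
      _ = _ := by simp only [hrel, Finset.mul_sum, mul_assoc]
  have hcrit : IsAlgebraic k (aeval x (G j₀)) := by
    by_contra hc
    obtain ⟨D, hD⟩ := exists_derivation_eq_one_of_transcendental hc
    have := contract fun i => D (x i)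
    simp only [← Derivation.map_mvPolynomial_aeval] at this
    rw [Finset.sum_eq_single j₀ (fun a _ ha => by simp [hxG a ha]) (by simp), hxh, hD, hl] at this
    simp at this
  have hEuler := contract x
  simp only [mul_comm _ (x _), MvPolynomial.IsHomogeneous.sum_mul_aeval_pderiv (hG _),
    hh.sum_mul_aeval_pderiv] at hEuler
  rw [Finset.sum_eq_single j₀ (fun a _ ha => by simp [hxG a ha]) (by simp), hxh, hl] at hEuler
  have : CharZero K := charZero_of_injective_algebraMap (algebraMap k K).injective
  have hd0 : (d : K) ≠ 0 := by exact_mod_cast (by omega : d ≠ 0)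
  obtain ⟨O, hO, hxO⟩ := exists_valuationSubring_notMem_of_transcendental hi₀
  refine exists_common_zero_at_infinity hh hG hd hde O (fun z => hO _ (isAlgebraic_algebraMap z))
    hxO hxh hxG (hO _ hcrit) (hO l₀ ?_) hl hrel
  have : l₀ = algebraMap k K ((e j₀ : k) / d) * aeval x (G j₀) := by
    simp only [map_div₀, map_natCast]
    field_simp
    linear_combination -hEuler
  rw [this]
  exact (isAlgebraic_algebraMap _).mul hcrit

theorem exists_sum_smul_eq_of_mem_span_range_sumElim {k M ι : Type} [Field k] [AddCommGroup M]
    [Module k M] [PartialOrder ι] [Fintype ι] {j : ι} {u : M} {v : ι → M}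
    [Fintype {a : ι // j < a}] [Fintype {a : ι // j ≤ a}]
    (hv : v j ∈ Submodule.span k
      (Set.range (Sum.elim (fun _ : Unit => u) (fun a : {a : ι // j < a} => v a)))) :
    ∃ (c₀ : k) (c : {a : ι // j ≤ a} → k), c ⟨j, le_rfl⟩ = 1 ∧ ∑ a, c a • v a = c₀ • u := by
  obtain ⟨b, hb⟩ := (Submodule.mem_span_range_iff_exists_fun k).1 hv
  let g : Option {a : ι // j < a} → {a : ι // j ≤ a} :=
    fun o => o.elim ⟨j, le_rfl⟩ (fun a => ⟨a, a.2.le⟩)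
  have hg : Function.Bijective g := by
    constructor
    · rintro (_ | ⟨a, ha⟩) (_ | ⟨b, hb⟩) hab
      · rfl
      · exact absurd (congrArg Subtype.val hab) hb.ne
      · exact absurd (congrArg Subtype.val hab) ha.ne'
      · simpa [g] using hab
    · rintro ⟨a, ha⟩
      rcases ha.eq_or_lt with rfl | hlt
      · exact ⟨none, rfl⟩
      · exact ⟨some ⟨a, hlt⟩, rfl⟩
  let e := Equiv.ofBijective g hg
  let l : Option {a : ι // j < a} → k := fun o => o.elim 1 (fun a => -b (Sum.inr a))
  refine ⟨b (Sum.inl ()), l ∘ e.symm, ?_, ?_⟩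
  · have : e.symm ⟨j, le_rfl⟩ = none := e.symm_apply_eq.2 rfl
    simp [this, l]
  · rw [← e.sum_comp, Fintype.sum_option]
    simp only [Function.comp_apply, Equiv.symm_apply_apply]
    simp only [Fintype.sum_sum_type, Sum.elim_inl, Sum.elim_inr, Finset.univ_unique,
      Finset.sum_singleton] at hb
    have h1 : v (e none) = v j := rfl
    rw [h1, ← hb]
    simp [l, e, g]

/-- **Step 3, condition (c1).**  Fix `j` (here `jj : Fin k` represents the index `j`, so that
`f jj` is `f_j` and the indices `a` with `jj < a` correspond to `f_{j+1}, …, f_k`).  If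
`d < d_a` for all `a`, `V_sing` is finite and disjoint from `H`, and the singular loci of
`Z_j` and `Z_{j+1}` are contained in `V_sing`, then the critical set `Σ_1` of `f_j` restricted
to the smooth part of `{f_{j+1} = ⋯ = f_k = 0, h = 1}` off `{f_j = 0}` is finite. -/
theorem critical_set_sigma_one_finite
    (n k N : ℕ) (hn : 1 ≤ n) (hk : 1 ≤ k) (hN : N = n + k)
    (d : ℕ) (dd : Fin k → ℕ) (hd : 1 ≤ d)
    (f : Fin k → MvPolynomial (Fin (N + 1)) ℂ)
    (h : MvPolynomial (Fin (N + 1)) ℂ)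
    (hf : ∀ a, (f a).IsHomogeneous (dd a))
    (hh : h.IsHomogeneous d)
    -- `d < d_a` for all `a`
    (hdeg : ∀ a, d < dd a)
    (Vsing Hset : Set (Projectivization ℂ (Fin (N + 1) → ℂ)))
    -- `Vsing` is the singular locus of `V`
    (hVsing : Vsing = {P | ∃ x, ∃ hx : x ≠ 0, P = Projectivization.mk ℂ x hx ∧
        (∀ a, eval x (f a) = 0) ∧
        ¬ LinearIndependent ℂ fun a => pgrad (f a) x})
    -- `Hset` is the hypersurface `H = {h = 0}`
    (hHset : Hset = {P | ∃ x, ∃ hx : x ≠ 0, P = Projectivization.mk ℂ x hx ∧ eval x h = 0})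
    -- `V_sing` is finite and `V_sing ∩ H = ∅`
    (hVsingFin : Vsing.Finite)
    (hVH : Vsing ∩ Hset = ∅)
    -- the fixed index `j`
    (jj : Fin k)
    -- `Z_{j,sing} ⊆ V_sing`
    (hZj : ∀ x, ∀ hx : x ≠ 0,
        (∀ a : Fin k, jj ≤ a → eval x (f a) = 0) →
        ¬ LinearIndependent ℂ (fun a : {a : Fin k // jj ≤ a} => pgrad (f a) x) →
        Projectivization.mk ℂ x hx ∈ Vsing)
    -- `Z_{j+1,sing} ⊆ V_sing`
    (hZj1 : ∀ x, ∀ hx : x ≠ 0,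
        (∀ a : Fin k, jj < a → eval x (f a) = 0) →
        ¬ LinearIndependent ℂ (fun a : {a : Fin k // jj < a} => pgrad (f a) x) →
        Projectivization.mk ℂ x hx ∈ Vsing) :
    -- the critical set `Σ_1` is finite
    Set.Finite {x : Fin (N + 1) → ℂ |
        (∀ a : Fin k, jj < a → eval x (f a) = 0) ∧ eval x h = 1 ∧ eval x (f jj) ≠ 0 ∧
        LinearIndependent ℂ
          (Sum.elim (fun _ : Unit => pgrad h x)
            (fun a : {a : Fin k // jj < a} => pgrad (f a) x)) ∧
        pgrad (f jj) x ∈ Submodule.span ℂ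
          (Set.range (Sum.elim (fun _ : Unit => pgrad h x)
            (fun a : {a : Fin k // jj < a} => pgrad (f a) x)))} := by
  by_contra hinf
  set S : Set (Fin (N + 1) → ℂ) := {x | _} with hS
  obtain ⟨i₀, hi₀⟩ : ∃ i, ((fun x : Fin (N + 1) → ℂ => x i) '' S).Infinite := by
    by_contra! hfin
    refine hinf ((Set.Finite.pi' (t := fun i => (fun x : Fin (N + 1) → ℂ => x i) '' S)
      hfin).subset fun x hx i => ⟨x, hx, rfl⟩)
  have hrel : ∀ s : S, ∃ (c₀ : ℂ) (c : {a : Fin k // jj ≤ a} → ℂ), c ⟨jj, le_rfl⟩ = 1 ∧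
      ∑ a, c a • pgrad (f a) s.1 = c₀ • pgrad h s.1 := fun s =>
    exists_sum_smul_eq_of_mem_span_range_sumElim (v := fun a => pgrad (f a) s.1) s.2.2.2.2.2
  choose c₀ c hc hrel using hrel
  obtain ⟨P, hP, htr⟩ := exists_prime_transcendental_mk (fun s : S => s.1 i₀)
    (by rwa [Set.image_eq_range] at hi₀)
  let K := FractionRing ((S → ℂ) ⧸ P)
  let q : (S → ℂ) →ₐ[ℂ] K :=
    (IsScalarTower.toAlgHom ℂ ((S → ℂ) ⧸ P) K).comp (Ideal.Quotient.mkₐ ℂ P)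
  have hq : ∀ p : MvPolynomial (Fin (N + 1)) ℂ,
      aeval (fun i => q fun s => s.1 i) p = q fun s => eval s.1 p := by
    intro p
    rw [← comp_aeval_apply]
    congr 1
    funext s
    have := comp_aeval_apply (fun i (s : S) => s.1 i) (Pi.evalAlgHom ℂ (fun _ : S => ℂ) s) p
    exact this.trans (by rw [← aeval_eq_eval]; rfl)
  obtain ⟨w, ν, hw, hν, hwh, hwG, hwr⟩ := exists_common_zero_of_transcendental (K := K) hh
    (G := fun a : {a : Fin k // jj ≤ a} => f a) (fun a => hf a) hd (j₀ := ⟨jj, le_rfl⟩)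
    (hdeg jj) (x := fun i => q fun s => s.1 i) (i₀ := i₀)
    ((transcendental_algebraMap_iff (IsFractionRing.injective ((S → ℂ) ⧸ P) K)).2 htr)
    (by
      rw [hq, ← map_one q]
      exact congrArg q (funext fun s => s.2.2.1))
    (fun a ha => by
      rw [hq, ← map_zero q]
      exact congrArg q (funext fun s => s.2.1 a (lt_of_le_of_ne a.2 fun h0 => ha (Subtype.ext h0.symm))))
    (l₀ := q c₀) (l := fun a => q fun s => c s a)
    (by
      rw [← map_one q]
      exact congrArg q (funext hc))
    (fun i => by
      simp only [hq, ← map_mul, ← map_sum]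
      congr 1
      funext s
      simpa [pgrad] using congrFun (hrel s) i)
  have hsing := hZj w hw (fun a ha => hwG ⟨a, ha⟩) (by
    rw [Fintype.not_linearIndependent_iff]
    refine ⟨ν, ?_, Function.ne_iff.1 hν⟩
    funext i
    simpa [pgrad] using hwr i)
  have : Projectivization.mk ℂ w hw ∈ Vsing ∩ Hset :=
    ⟨hsing, by rw [hHset]; exact ⟨w, hw, rfl, hwh⟩⟩
  simp [hVH] at this
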